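/- arXiv:1904.09496 — 9 statements merged into one kernel-verified Lean document; each statement's English description precedes it below -/
import Mathlib

section
/- Let G ≥ 2, k > 0, and for each j ∈ {1, …, G} let r_j > 0 and c_j > 0 be reals, and define λ_j(l) = (l/k) · c_j for l > 0. Suppose (l_1*, …, l_G*) with all l_j* > 0 and Σ_{j=1}^{G} r_j l_j* = k attains the minimum of max_{j ∈ [G]} λ_j(l_j) over all (l_1, …, l_G) with l_j > 0 and Σ_{j=1}^{G} r_j l_j = k. Then λ_j(l_j*) = λ_{j'}(l_{j'}*) for all j, j' ∈ {1, …, G}, i.e., l_j* c_j = l_{j'}* c_{j'}. -/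
/-- `G`-group balancing theorem: an optimal load allocation `(l₁*, …, l_G*)` under the MDS
recovery constraint `Σ_j r_j l_j = k` equalizes all groups' expected latencies
`λ_j(l) = (l/k)·c_j`. -/
theorem G_group_balancing
    (G : ℕ) (hG : 2 ≤ G) (hne : (Finset.univ : Finset (Fin G)).Nonempty)
    (k : ℝ) (hk : 0 < k)
    (r c : Fin G → ℝ) (hr : ∀ j, 0 < r j) (hc : ∀ j, 0 < c j)
    (l : Fin G → ℝ) (hl : ∀ j, 0 < l j)
    (hcon : ∑ j, r j * l j = k)
    (hmin : ∀ m : Fin G → ℝ, (∀ j, 0 < m j) → ∑ j, r j * m j = k →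
      (Finset.univ.sup' hne fun j => (l j / k) * c j) ≤
        Finset.univ.sup' hne fun j => (m j / k) * c j) :
    ∀ j j' : Fin G, (l j / k) * c j = (l j' / k) * c j' := by
  have hS : 0 < ∑ j, r j / c j := Finset.sum_pos (fun j _ => div_pos (hr j) (hc j)) hne
  set S := ∑ j, r j / c j with hSdef
  have hm : ∑ j, r j * (k / (S * c j)) = k := by
    have h1 : ∀ j, r j * (k / (S * c j)) = (k / S) * (r j / c j) := by
      intro j
      have := (hc j).ne'
      field_simp
    rw [Finset.sum_congr rfl (fun j _ => h1 j), ← Finset.mul_sum, ← hSdef]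
    field_simp
  have hlat : ∀ j, (k / (S * c j) / k) * c j = 1 / S := by
    intro j
    have := (hc j).ne'
    field_simp
  have key := hmin (fun j => k / (S * c j)) (fun j => div_pos hk (mul_pos hS (hc j))) hm
  have hle : ∀ j, (l j / k) * c j ≤ 1 / S := by
    intro j
    refine (Finset.le_sup' (fun j => (l j / k) * c j) (Finset.mem_univ j)).trans (key.trans ?_)
    exact Finset.sup'_le _ _ (fun i _ => (hlat i).le)
  have hle2 : ∀ j, r j * l j ≤ r j * (k / (S * c j)) := by
    intro j
    have h2 := hle j
    rw [← hlat j] at h2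
    have h3 := le_of_mul_le_mul_right h2 (hc j)
    have h4 := (div_le_div_iff_of_pos_right hk).1 h3
    exact mul_le_mul_of_nonneg_left h4 (hr j).le
  have heq := (Finset.sum_eq_sum_iff_of_le (fun j _ => hle2 j)).1 (hcon.trans hm.symm)
  have hfin : ∀ j, (l j / k) * c j = 1 / S := by
    intro j
    have h5 := mul_left_cancel₀ (hr j).ne' (heq j (Finset.mem_univ j))
    rw [h5, hlat j]
  intro j j'
  rw [hfin j, hfin j']
end

section
/- Let G ≥ 1 and for each j ∈ {1, …, G} let N_j, μ_j, α_j > 0. Define S = ∏_{j=1}^{G} (0, N_j) ⊂ ℝ^G and, for r = (r_1, …, r_G) ∈ S, f(r) = 1 / ( Σ_{j=1}^{G} r_j / ξ_j(r_j) ), where ξ_j(r) = α_j + (1/μ_j)·log(N_j/(N_j − r)). Then f is strictly convex on S. -/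
open Real

lemma xi_pos_aux {N μ α r : ℝ} (hμ : 0 < μ) (hα : 0 < α) (h0 : 0 < r) (h1 : r < N) :
    0 < α + (1 / μ) * Real.log (N / (N - r)) := by
  have : 0 < Real.log (N / (N - r)) := by
    apply Real.log_pos
    rw [lt_div_iff₀ (by linarith)]; linarith
  positivity

lemma log_bound_aux {N r : ℝ} (h0 : 0 < r) (h1 : r < N) :
    2 * r ≤ Real.log (N / (N - r)) * (2 * N - r) := by
  have hd : 0 < N - r := by linarith
  have h := Real.le_log_one_add_of_nonneg (x := r / (N - r)) (by positivity)
  have e1 : 1 + r / (N - r) = N / (N - r) := by field_simp; ring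
  have e2 : 2 * (r / (N - r)) / (r / (N - r) + 2) = 2 * r / (2 * N - r) := by
    have h3 : 2 * N - r ≠ 0 := by linarith
    have h4 : r / (N - r) + 2 = (2 * N - r) / (N - r) := by field_simp; ring
    rw [h4]; field_simp
  rw [e1, e2, div_le_iff₀ (by linarith)] at h
  exact h

lemma xi_deriv_aux {N μ α r : ℝ} (h0 : 0 < r) (h1 : r < N) :
    HasDerivAt (fun r => α + (1 / μ) * Real.log (N / (N - r))) ((1 / μ) * (1 / (N - r))) r := by
  have hd : 0 < N - r := by linarith
  have hN : 0 < N := by linarith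
  have h2 : HasDerivAt (fun r : ℝ => N - r) (-1) r := by
    simpa using (hasDerivAt_id r).const_sub N
  have h3 := (((hasDerivAt_const r N).div h2 hd.ne').log (div_pos hN hd).ne').const_mul (1 / μ)
  have h4 := h3.const_add α
  refine h4.congr_deriv ?_
  try simp only [Pi.div_apply]
  field_simp
  ring

lemma one_dim_aux {N μ α : ℝ} (hμ : 0 < μ) (hα : 0 < α) :
    StrictConcaveOn ℝ (Set.Ioo 0 N)
      (fun r => r / (α + (1 / μ) * Real.log (N / (N - r)))) := by
  have hder : ∀ r ∈ Set.Ioo 0 N, HasDerivAt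
      (fun r => r / (α + (1 / μ) * Real.log (N / (N - r))))
      (((α + (1 / μ) * Real.log (N / (N - r))) - r * ((1 / μ) * (1 / (N - r)))) /
        (α + (1 / μ) * Real.log (N / (N - r))) ^ 2) r := by
    rintro r ⟨h0, h1⟩
    have := (hasDerivAt_id r).div (xi_deriv_aux (μ := μ) (α := α) h0 h1)
      (xi_pos_aux hμ hα h0 h1).ne'
    refine this.congr_deriv ?_
    simp
  refine strictConcaveOn_of_deriv2_neg (convex_Ioo 0 N)
    (fun r hr => (hder r hr).continuousAt.continuousWithinAt) ?_
  intro r hr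
  rw [interior_Ioo] at hr
  have hev : deriv (fun r => r / (α + (1 / μ) * Real.log (N / (N - r)))) =ᶠ[nhds r]
      (fun r => ((α + (1 / μ) * Real.log (N / (N - r))) - r * ((1 / μ) * (1 / (N - r)))) /
        (α + (1 / μ) * Real.log (N / (N - r))) ^ 2) := by
    filter_upwards [isOpen_Ioo.mem_nhds hr] with s hs using (hder s hs).deriv
  simp only [Function.iterate_succ, Function.iterate_zero, Function.comp_apply, id_eq]
  rw [hev.deriv_eq]
  obtain ⟨h0, h1⟩ := hr
  have hd : 0 < N - r := by linarith
  have hx := xi_deriv_aux (μ := μ) (α := α) h0 h1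
  have hp := xi_pos_aux hμ hα h0 h1
  have h2 : HasDerivAt (fun r : ℝ => N - r) (-1) r := by
    simpa using (hasDerivAt_id r).const_sub N
  have h3 : HasDerivAt (fun r : ℝ => r * ((1 / μ) * (1 / (N - r))))
      ((1 / μ) * (1 / (N - r)) + r * ((1 / μ) * (1 / (N - r) ^ 2))) r := by
    have := (hasDerivAt_id r).mul (((hasDerivAt_const r (1:ℝ)).div h2 hd.ne').const_mul (1 / μ))
    refine this.congr_deriv ?_
    simp
  have h4 := (hx.sub h3).div (hx.pow 2) (pow_pos hp 2).ne'
  have h5 := h4.deriv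
  have hb := log_bound_aux h0 h1
  refine (lt_of_eq_of_lt h5 ?_)
  simp only [Pi.sub_apply, Pi.pow_apply]
  set L := Real.log (N / (N - r)) with hL
  set X := α + 1 / μ * L with hX
  have key : 2 * r < μ * X * (2 * N - r) := by
    have : μ * X = μ * α + L := by rw [hX]; field_simp
    rw [this]
    nlinarith [mul_pos (mul_pos hμ hα) (show 0 < 2 * N - r by linarith)]
  have e : (((1 / μ * (1 / (N - r)) - (1 / μ * (1 / (N - r)) + r * (1 / μ * (1 / (N - r) ^ 2)))) * X ^ 2 -
      (X - r * (1 / μ * (1 / (N - r)))) * ((2:ℕ) * X ^ (2 - 1) * (1 / μ * (1 / (N - r))))) / (X ^ 2) ^ 2)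
      = (2 * r - μ * X * (2 * N - r)) / (μ ^ 2 * (N - r) ^ 2 * X ^ 3) := by
    clear_value X
    push_cast
    field_simp
    ring
  rw [e]
  exact div_neg_of_neg_of_pos (by linarith) (by positivity)

/-- The latency lower bound `f(r) = 1/(Σ_j r_j/ξ_j(r_j))` with
`ξ_j(r) = α_j + (1/μ_j)·log(N_j/(N_j − r))` is strictly convex on the open box
`S = ∏_j (0, N_j)`. -/
theorem latency_lower_bound_strictly_convex
    (G : ℕ) (hG : 1 ≤ G)
    (N μ α : Fin G → ℝ)
    (hN : ∀ j, 0 < N j) (hμ : ∀ j, 0 < μ j) (hα : ∀ j, 0 < α j) :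
    StrictConvexOn ℝ (Set.univ.pi fun j => Set.Ioo (0 : ℝ) (N j))
      (fun r : Fin G → ℝ =>
        1 / ∑ j, r j / (α j + (1 / μ j) * Real.log (N j / (N j - r j)))) := by
  have hconc := fun j => one_dim_aux (N := N j) (hμ j) (hα j)
  have hpos : ∀ r ∈ (Set.univ.pi fun j => Set.Ioo (0 : ℝ) (N j)),
      0 < ∑ j, r j / (α j + (1 / μ j) * Real.log (N j / (N j - r j))) := by
    intro r hr
    apply Finset.sum_pos
    · intro j _
      obtain ⟨h0, h1⟩ := hr j trivial
      exact div_pos h0 (xi_pos_aux (hμ j) (hα j) h0 h1)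
    · exact ⟨⟨0, hG⟩, Finset.mem_univ _⟩
  refine ⟨convex_pi fun j _ => convex_Ioo _ _, ?_⟩
  intro x hx y hy hxy a b ha hb hab
  have hpx := hpos x hx
  have hpy := hpos y hy
  have hlt : a * (∑ j, x j / (α j + (1 / μ j) * Real.log (N j / (N j - x j)))) +
      b * (∑ j, y j / (α j + (1 / μ j) * Real.log (N j / (N j - y j)))) <
      ∑ j, (a • x + b • y) j / (α j + (1 / μ j) * Real.log (N j / (N j - (a • x + b • y) j))) := by
    rw [Finset.mul_sum, Finset.mul_sum, ← Finset.sum_add_distrib]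
    obtain ⟨i, hi⟩ := Function.ne_iff.mp hxy
    apply Finset.sum_lt_sum
    · intro j _
      exact (hconc j).concaveOn.2 (hx j trivial) (hy j trivial) ha.le hb.le hab
    · exact ⟨i, Finset.mem_univ _, (hconc i).2 (hx i trivial) (hy i trivial) hi ha hb hab⟩
  simp only [smul_eq_mul]
  generalize (∑ j, x j / (α j + (1 / μ j) * Real.log (N j / (N j - x j)))) = A at *
  generalize (∑ j, y j / (α j + (1 / μ j) * Real.log (N j / (N j - y j)))) = B at *
  have hm : 0 < a * A + b * B := by positivity
  refine (one_div_lt_one_div_of_lt hm hlt).trans_le ?_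
  rw [div_le_iff₀ hm]
  have : (a * (1 / A) + b * (1 / B)) * (a * A + b * B) - 1 = a * b * (A - B) ^ 2 / (A * B) := by
    obtain rfl : b = 1 - a := by linarith
    field_simp
    ring
  have h2 : 0 ≤ a * b * (A - B) ^ 2 / (A * B) := by positivity
  linarith
end

section
/- Let N, μ, α > 0 be reals. Define h : [0, N) → ℝ by h(0) = 0 and h(x) = x / ( α + (1/μ)·log(N/(N − x)) ) for 0 < x < N. Then h is concave on [0, N). -/
open Real

/-- The function `h(x) = x/(α + (1/μ)·log(N/(N − x)))` (with `h(0) = 0`) is concave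
on `[0, N)`. -/
theorem summand_concave
    (N μ α : ℝ) (hN : 0 < N) (hμ : 0 < μ) (hα : 0 < α) :
    ConcaveOn ℝ (Set.Ico (0 : ℝ) N)
      (fun x : ℝ => x / (α + (1 / μ) * Real.log (N / (N - x)))) := by
  obtain ⟨m, hm⟩ : ∃ m, m = 1 / μ := ⟨_, rfl⟩
  have hm0 : 0 < m := by rw [hm]; positivity
  rw [← hm]
  have hlog : ∀ x, 0 ≤ x → x < N → 2 * x / (2 * N - x) ≤ Real.log (N / (N - x)) := by
    intro x hx hxN
    have h1 : 0 < N - x := by linarith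
    have h2 : 0 < 2 * N - x := by linarith
    have h := Real.le_log_one_add_of_nonneg (x := x / (N - x)) (by positivity)
    have e1 : 1 + x / (N - x) = N / (N - x) := by field_simp; ring
    have h3 : 0 < x / (N - x) + 2 := by positivity
    have e2 : 2 * (x / (N - x)) / (x / (N - x) + 2) = 2 * x / (2 * N - x) := by
      rw [div_eq_div_iff h3.ne' h2.ne']
      field_simp
      ring
    rwa [e1, e2] at h
  have hpos : ∀ x, 0 ≤ x → x < N → 0 < α + m * Real.log (N / (N - x)) := by
    intro x hx hxN
    have h2 : 0 < 2 * N - x := by linarith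
    have h := hlog x hx hxN
    have : 0 ≤ 2 * x / (2 * N - x) := by positivity
    have : 0 ≤ m * Real.log (N / (N - x)) := mul_nonneg hm0.le (this.trans h)
    linarith
  have hd : ∀ x, 0 ≤ x → x < N →
      HasDerivAt (fun x => α + m * Real.log (N / (N - x))) (m / (N - x)) x := by
    intro x hx hxN
    have h1 : 0 < N - x := by linarith
    have h0 : HasDerivAt (fun x => N - x) (-1) x := (hasDerivAt_id x).const_sub N
    have := ((((hasDerivAt_const x N).fun_div h0 h1.ne').log (by positivity)).const_mul m).const_add α
    refine this.congr_deriv ?_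
    field_simp
    ring
  have hd1 : ∀ x, 0 ≤ x → x < N →
      HasDerivAt (fun x => x / (α + m * Real.log (N / (N - x))))
        ((1 * (α + m * Real.log (N / (N - x))) - x * (m / (N - x))) /
          (α + m * Real.log (N / (N - x))) ^ 2) x := by
    intro x hx hxN
    exact (hasDerivAt_id x).fun_div (hd x hx hxN) (hpos x hx hxN).ne'
  have hd2 : ∀ x, 0 ≤ x → x < N →
      HasDerivAt (fun x => (1 * (α + m * Real.log (N / (N - x))) - x * (m / (N - x))) /
          (α + m * Real.log (N / (N - x))) ^ 2)
        (m * (2 * m * x - (α + m * Real.log (N / (N - x))) * (2 * N - x)) /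
          ((N - x) ^ 2 * (α + m * Real.log (N / (N - x))) ^ 3)) x := by
    intro x hx hxN
    have h1 : 0 < N - x := by linarith
    have h0 : HasDerivAt (fun x => N - x) (-1) x := (hasDerivAt_id x).const_sub N
    have hp := hpos x hx hxN
    have hD := hd x hx hxN
    have := ((hD.const_mul 1).fun_sub ((hasDerivAt_id x).fun_mul
      ((hasDerivAt_const x m).fun_div h0 h1.ne'))).fun_div (hD.fun_pow 2) (by positivity)
    refine this.congr_deriv ?_
    simp only [id]
    generalize α + m * Real.log (N / (N - x)) = y at hp
    field_simp
    ring
  refine concaveOn_of_hasDerivWithinAt2_nonpos (convex_Ico 0 N)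
    (fun x hx => (hd1 x hx.1 hx.2).continuousAt.continuousWithinAt)
    (fun x hx => (hd1 x (interior_subset hx).1 (interior_subset hx).2).hasDerivWithinAt)
    (fun x hx => (hd2 x (interior_subset hx).1 (interior_subset hx).2).hasDerivWithinAt) ?_
  intro x hx
  obtain ⟨hx0, hxN⟩ := interior_subset hx
  have hp := hpos x hx0 hxN
  have h2 : 0 < 2 * N - x := by linarith
  have h := hlog x hx0 hxN
  rw [div_le_iff₀ h2] at h
  apply div_nonpos_of_nonpos_of_nonneg _ (by positivity)
  apply mul_nonpos_of_nonneg_of_nonpos hm0.le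
  nlinarith [mul_le_mul_of_nonneg_left h hm0.le, mul_pos hα h2]
end

section
/- Let N, μ, α > 0 be reals. There exists exactly one r ∈ (0, N) such that r / ( μ·(N − r) ) = α + (1/μ)·log( N/(N − r) ). -/
open Real

lemma aux_lt (a b : ℝ) (ha : 1 < a) (hab : a < b) :
    a - 1 - Real.log a < b - 1 - Real.log b := by
  have ha0 : 0 < a := by linarith
  have h1 : Real.log (b / a) < b / a - 1 := by
    apply Real.log_lt_sub_one_of_pos (by apply div_pos <;> linarith)
    intro h
    rw [div_eq_one_iff_eq ha0.ne'] at h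
    linarith
  rw [Real.log_div (by linarith) ha0.ne'] at h1
  have h2 : b / a - 1 ≤ b - a := by
    have : b / a - 1 = (b - a) / a := by field_simp
    rw [this]
    exact div_le_self (by linarith) ha.le
  linarith

lemma aux_ex (c : ℝ) (hc : 0 < c) : ∃ t : ℝ, 1 < t ∧ t - 1 - Real.log t = c := by
  have hT : (1 : ℝ) ≤ (2 + c) ^ 2 := by nlinarith
  have hcont : ContinuousOn (fun t : ℝ => t - 1 - Real.log t) (Set.Icc 1 ((2 + c) ^ 2)) := by
    apply ContinuousOn.sub (by fun_prop)
    apply Real.continuousOn_log.mono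
    intro x hx
    have := hx.1
    simp only [Set.mem_compl_iff, Set.mem_singleton_iff]
    intro h
    linarith
  have hl : Real.log ((2 + c) ^ 2) ≤ 2 * (1 + c) := by
    rw [Real.log_pow]
    have := Real.log_le_sub_one_of_pos (show 0 < 2 + c by linarith)
    push_cast
    linarith
  obtain ⟨t, ht, hte⟩ := intermediate_value_Icc hT hcont
    (show c ∈ Set.Icc _ _ from ⟨by simp; linarith, by nlinarith⟩)
  refine ⟨t, lt_of_le_of_ne ht.1 ?_, hte⟩
  rintro rfl
  simp at hte
  linarith

lemma aux_iff (N μ α r : ℝ) (hμ : 0 < μ) (hr : r < N) :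
    r / (μ * (N - r)) = α + (1 / μ) * Real.log (N / (N - r)) ↔
      N / (N - r) - 1 - Real.log (N / (N - r)) = α * μ := by
  have h : N - r ≠ 0 := by linarith
  have h1 : r / (μ * (N - r)) = (N / (N - r) - 1) / μ := by
    field_simp
    ring
  rw [h1]
  generalize Real.log (N / (N - r)) = L
  generalize N / (N - r) = t
  rw [div_eq_iff hμ.ne', add_mul]
  have : 1 / μ * L * μ = L := by field_simp
  rw [this]
  constructor <;> intro h <;> linarith

/-- For `N, μ, α > 0` there is exactly one `r ∈ (0, N)` with
`r/(μ(N − r)) = α + (1/μ)·log(N/(N − r))`. -/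
theorem unique_stationary_point
    (N μ α : ℝ) (hN : 0 < N) (hμ : 0 < μ) (hα : 0 < α) :
    ∃! r : ℝ, r ∈ Set.Ioo (0 : ℝ) N ∧
      r / (μ * (N - r)) = α + (1 / μ) * Real.log (N / (N - r)) := by
  obtain ⟨t, ht, hte⟩ := aux_ex (α * μ) (mul_pos hα hμ)
  have ht0 : 0 < t := by linarith
  have hd : 0 < N / t := div_pos hN ht0
  refine ⟨N - N / t, ⟨⟨?_, by linarith⟩, ?_⟩, ?_⟩
  · have := div_lt_self hN ht
    linarith
  · rw [aux_iff N μ α _ hμ (by linarith)]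
    have : N / (N - (N - N / t)) = t := by
      rw [sub_sub_cancel]
      field_simp
    rw [this, hte]
  · rintro r ⟨⟨h0, h1⟩, h⟩
    rw [aux_iff N μ α r hμ h1] at h
    have hp : 0 < N - r := by linarith
    have hs : 1 < N / (N - r) := by
      rw [lt_div_iff₀ hp]
      linarith
    have : N / (N - r) = t := by
      rcases lt_trichotomy (N / (N - r)) t with hlt | heq | hgt
      · have := aux_lt _ _ hs hlt
        linarith
      · exact heq
      · have := aux_lt _ _ ht hgt
        linarith
    rw [← this, div_div_cancel₀ hN.ne']
    ring
end

section
/- Let G ≥ 1 and for each j ∈ {1, …, G} let N_j, μ_j, α_j > 0. Define f on S = ∏_{j=1}^{G} (0, N_j) by f(r) = 1 / ( Σ_{j=1}^{G} r_j / ξ_j(r_j) ), where ξ_j(r) = α_j + (1/μ_j)·log(N_j/(N_j − r)). Then for every r ∈ S and every index j, the partial derivative ∂f/∂r_j vanishes at r if and only if r_j / ( μ_j·(N_j − r_j) ) = α_j + (1/μ_j)·log( N_j/(N_j − r_j) ). -/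
open Real

/-- For the latency lower bound `f(r) = 1/(Σ_j r_j/ξ_j(r_j))` on the open box
`S = ∏_j (0, N_j)`, the partial derivative `∂f/∂r_j` vanishes at `r` iff
`r_j/(μ_j(N_j − r_j)) = α_j + (1/μ_j)·log(N_j/(N_j − r_j))`. -/
theorem partial_derivative_zero_iff
    (G : ℕ) (hG : 1 ≤ G)
    (N μ α : Fin G → ℝ)
    (hN : ∀ j, 0 < N j) (hμ : ∀ j, 0 < μ j) (hα : ∀ j, 0 < α j)
    (r : Fin G → ℝ) (hr : r ∈ Set.univ.pi fun j => Set.Ioo (0 : ℝ) (N j)) :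
    ∀ j : Fin G,
      deriv (fun t : ℝ =>
          1 / ∑ j', (Function.update r j t) j' /
            (α j' + (1 / μ j') * Real.log (N j' / (N j' - (Function.update r j t) j')))) (r j) = 0
        ↔ r j / (μ j * (N j - r j)) = α j + (1 / μ j) * Real.log (N j / (N j - r j)) := by
  intro j
  have hr' : ∀ i, 0 < r i ∧ r i < N i := fun i => hr i (Set.mem_univ i)
  have hX : ∀ i, 0 < α i + (1 / μ i) * Real.log (N i / (N i - r i)) := by
    intro i
    obtain ⟨h0, h1⟩ := hr' i
    have h2 : 0 ≤ Real.log (N i / (N i - r i)) := by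
      apply Real.log_nonneg
      rw [le_div_iff₀ (by linarith)]
      linarith
    have h3 := hα i
    have h4 := hμ i
    positivity
  have hfun : (fun t : ℝ => ∑ j', (Function.update r j t) j' /
            (α j' + (1 / μ j') * Real.log (N j' / (N j' - (Function.update r j t) j'))))
      = fun t : ℝ => t / (α j + (1 / μ j) * Real.log (N j / (N j - t))) +
          ∑ j' ∈ Finset.univ.erase j, r j' /
            (α j' + (1 / μ j') * Real.log (N j' / (N j' - r j'))) := by
    funext t
    rw [← Finset.add_sum_erase _ _ (Finset.mem_univ j)]
    congr 1
    · simp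
    · apply Finset.sum_congr rfl
      intro i hi
      rw [Function.update_of_ne (Finset.ne_of_mem_erase hi)]
  obtain ⟨h0, h1⟩ := hr' j
  have hm := hμ j
  have hNj := hN j
  have hd : 0 < N j - r j := by linarith
  have hXj := hX j
  have hξ : HasDerivAt (fun t : ℝ => α j + (1 / μ j) * Real.log (N j / (N j - t)))
      (1 / (μ j * (N j - r j))) (r j) := by
    have a1 : HasDerivAt (fun t : ℝ => N j - t) (-1) (r j) := by
      simpa using (hasDerivAt_id (r j)).const_sub (N j)
    have a2 := (((hasDerivAt_const (r j) (N j)).fun_div a1 hd.ne').log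
      (by positivity)).const_mul (1 / μ j) |>.const_add (α j)
    refine a2.congr_deriv ?_
    have hd' := hd.ne'
    field_simp
    ring
  have hq := ((hasDerivAt_id' (r j)).fun_div hξ hXj.ne').add_const
    (∑ j' ∈ Finset.univ.erase j, r j' /
            (α j' + (1 / μ j') * Real.log (N j' / (N j' - r j'))))
  have hS : 0 < r j / (α j + (1 / μ j) * Real.log (N j / (N j - r j))) +
      ∑ j' ∈ Finset.univ.erase j, r j' /
            (α j' + (1 / μ j') * Real.log (N j' / (N j' - r j'))) := by
    apply add_pos_of_pos_of_nonneg (div_pos h0 hXj)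
    exact Finset.sum_nonneg fun i _ => (div_pos (hr' i).1 (hX i)).le
  have hf := (hasDerivAt_const (r j) (1 : ℝ)).fun_div hq hS.ne'
  have hfun2 := congrArg (fun F : ℝ → ℝ => fun t => 1 / F t) hfun
  beta_reduce at hfun2
  rw [hfun2, hf.deriv, div_eq_zero_iff, or_iff_left (pow_ne_zero 2 hS.ne')]
  rw [zero_mul, zero_sub, one_mul, neg_eq_zero, div_eq_zero_iff,
    or_iff_left (pow_ne_zero 2 hXj.ne'), one_mul, mul_one_div, sub_eq_zero]
  exact eq_comm
end

section
/- Let G ≥ 1 and for each j ∈ {1, …, G} let N_j, μ_j, α_j > 0. Let r_j* ∈ (0, N_j) be the unique solution of r/(μ_j(N_j − r)) = α_j + (1/μ_j)·log(N_j/(N_j − r)). Define f on S = ∏_{j=1}^{G} (0, N_j) by f(r) = 1 / ( Σ_{j=1}^{G} r_j / ξ_j(r_j) ), where ξ_j(r) = α_j + (1/μ_j)·log(N_j/(N_j − r)). Then f attains its global minimum on S uniquely at r* = (r_1*, …, r_G*), and the minimum value equals f(r*) = 1 / ( Σ_{j=1}^{G} μ_j·(N_j − r_j*) ). -/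
open Real

theorem aux_xi_pos (N μ α r : ℝ) (hμ : 0 < μ) (hα : 0 < α) (hr : r ∈ Set.Ioo (0 : ℝ) N) :
    0 < α + (1 / μ) * Real.log (N / (N - r)) := by
  obtain ⟨h0, h1⟩ := hr
  have : 0 ≤ Real.log (N / (N - r)) := by
    apply Real.log_nonneg
    rw [le_div_iff₀ (by linarith)]
    linarith
  positivity

theorem aux_eq (N μ α s : ℝ) (hμ : 0 < μ) (hs : s ∈ Set.Ioo (0 : ℝ) N)
    (h : s / (μ * (N - s)) = α + (1 / μ) * Real.log (N / (N - s))) :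
    s / (α + (1 / μ) * Real.log (N / (N - s))) = μ * (N - s) := by
  obtain ⟨h0, h1⟩ := hs
  have : 0 < N - s := by linarith
  rw [← h]
  field_simp

theorem aux_lt_s9 (N μ α s r : ℝ) (hμ : 0 < μ) (hα : 0 < α)
    (hs : s ∈ Set.Ioo (0 : ℝ) N) (hr : r ∈ Set.Ioo (0 : ℝ) N)
    (h : s / (μ * (N - s)) = α + (1 / μ) * Real.log (N / (N - s))) (hne : r ≠ s) :
    r / (α + (1 / μ) * Real.log (N / (N - r))) < μ * (N - s) := by
  have hx := aux_xi_pos N μ α r hμ hα hr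
  obtain ⟨h0, h1⟩ := hs
  obtain ⟨h2, h3⟩ := hr
  have a : 0 < N - s := by linarith
  have b : 0 < N - r := by linarith
  have c : 0 < N := by linarith
  rw [div_lt_iff₀ hx]
  have hl : Real.log ((N - r) / (N - s)) < (N - r) / (N - s) - 1 := by
    apply Real.log_lt_sub_one_of_pos (by positivity)
    intro h
    rw [div_eq_one_iff_eq a.ne'] at h
    exact hne (by linarith)
  rw [Real.log_div b.ne' a.ne'] at hl
  rw [Real.log_div c.ne' a.ne'] at h
  rw [Real.log_div c.ne' b.ne']
  have hs' : s = (N - s) * (μ * α + (Real.log N - Real.log (N - s))) := by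
    field_simp at h
    linarith
  have e : μ * (N - s) * (α + 1 / μ * (Real.log N - Real.log (N - r)))
      = (N - s) * (μ * α + (Real.log N - Real.log (N - r))) := by
    field_simp
  rw [e]
  have hm := mul_lt_mul_of_pos_left hl a
  have e2 : (N - s) * ((N - r) / (N - s) - 1) = s - r := by
    field_simp
    ring
  rw [e2] at hm
  linarith

/-- The latency lower bound `f(r) = 1/(Σ_j r_j/ξ_j(r_j))` attains its global minimum on the
open box `S = ∏_j (0, N_j)` uniquely at `r* = (r_1*, …, r_G*)`, where `r_j*` is the unique
solution of `r/(μ_j(N_j − r)) = α_j + (1/μ_j)·log(N_j/(N_j − r))`, and the minimum value is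
`1/(Σ_j μ_j(N_j − r_j*))`. -/
theorem latency_lower_bound_minimum
    (G : ℕ) (hG : 1 ≤ G)
    (N μ α : Fin G → ℝ)
    (hN : ∀ j, 0 < N j) (hμ : ∀ j, 0 < μ j) (hα : ∀ j, 0 < α j)
    (rstar : Fin G → ℝ)
    (hstar : ∀ j, rstar j ∈ Set.Ioo (0 : ℝ) (N j) ∧
      rstar j / (μ j * (N j - rstar j)) = α j + (1 / μ j) * Real.log (N j / (N j - rstar j)))
    (huniq : ∀ j, ∀ r ∈ Set.Ioo (0 : ℝ) (N j),
      r / (μ j * (N j - r)) = α j + (1 / μ j) * Real.log (N j / (N j - r)) → r = rstar j) :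
    (∀ r ∈ Set.univ.pi fun j => Set.Ioo (0 : ℝ) (N j),
        (1 / ∑ j, rstar j / (α j + (1 / μ j) * Real.log (N j / (N j - rstar j)))) ≤
          1 / ∑ j, r j / (α j + (1 / μ j) * Real.log (N j / (N j - r j)))) ∧
    (∀ r ∈ Set.univ.pi fun j => Set.Ioo (0 : ℝ) (N j),
        (1 / ∑ j, r j / (α j + (1 / μ j) * Real.log (N j / (N j - r j)))) =
          (1 / ∑ j, rstar j / (α j + (1 / μ j) * Real.log (N j / (N j - rstar j)))) →
        r = rstar) ∧
    (1 / ∑ j, rstar j / (α j + (1 / μ j) * Real.log (N j / (N j - rstar j)))) =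
      1 / ∑ j, μ j * (N j - rstar j) := by
  haveI : Nonempty (Fin G) := ⟨⟨0, hG⟩⟩
  have hE : ∀ j, rstar j / (α j + (1 / μ j) * Real.log (N j / (N j - rstar j)))
      = μ j * (N j - rstar j) := fun j => aux_eq _ _ _ _ (hμ j) (hstar j).1 (hstar j).2
  have hle : ∀ r ∈ Set.univ.pi fun j => Set.Ioo (0 : ℝ) (N j), ∀ j,
      r j / (α j + (1 / μ j) * Real.log (N j / (N j - r j))) ≤ μ j * (N j - rstar j) := by
    intro r hr j
    by_cases h : r j = rstar j
    · rw [h, hE]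
    · exact (aux_lt_s9 _ _ _ _ _ (hμ j) (hα j) (hstar j).1 (hr j trivial) (hstar j).2 h).le
  have hpos : ∀ r ∈ Set.univ.pi fun j => Set.Ioo (0 : ℝ) (N j),
      0 < ∑ j, r j / (α j + (1 / μ j) * Real.log (N j / (N j - r j))) := by
    intro r hr
    apply Finset.sum_pos _ Finset.univ_nonempty
    intro j _
    exact div_pos (hr j trivial).1 (aux_xi_pos _ _ _ _ (hμ j) (hα j) (hr j trivial))
  simp only [hE]
  refine ⟨fun r hr => ?_, fun r hr h => ?_, trivial⟩
  · exact one_div_le_one_div_of_le (hpos r hr) (Finset.sum_le_sum fun j _ => hle r hr j)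
  · have h' : ∑ j, r j / (α j + (1 / μ j) * Real.log (N j / (N j - r j)))
        = ∑ j, μ j * (N j - rstar j) := by
      simpa only [one_div, inv_inj] using h
    rw [Finset.sum_eq_sum_iff_of_le fun j _ => hle r hr j] at h'
    funext j
    by_contra hne
    exact (aux_lt_s9 _ _ _ _ _ (hμ j) (hα j) (hstar j).1 (hr j trivial) (hstar j).2 hne).ne
      (h' j (Finset.mem_univ j))
end

section
/- Let G = 2, k > 0, l > 0, α > 0, and for j ∈ {1, 2} let N_j, μ_j > 0. Fix r > 0 and define, for r_j ∈ (0, N_j), λ_j(r_j) = (l/k)·( α + (1/μ_j)·log( N_j/(N_j − r_j) ) ). Suppose (r_1*, r_2*) with r_j* ∈ (0, N_j) and r_1* + r_2* = r attains the minimum of max{λ_1(r_1), λ_2(r_2)} over all (r_1, r_2) with r_j ∈ (0, N_j) and r_1 + r_2 = r. Then λ_1(r_1*) = λ_2(r_2*). -/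
open Real

theorem key_aux (f g : ℝ → ℝ) (a b x y : ℝ) (hx : x ∈ Set.Ioo 0 a) (hy : y ∈ Set.Ioo 0 b)
    (hf : StrictMonoOn f (Set.Ioo 0 a)) (hg : ContinuousAt g y) (h : g y < f x) :
    ∃ s t, s ∈ Set.Ioo 0 a ∧ t ∈ Set.Ioo 0 b ∧ s + t = x + y ∧ f s < f x ∧ g t < f x := by
  have h1 : ∀ᶠ t in nhds y, g t < f x := hg.eventually (gt_mem_nhds h)
  obtain ⟨ε, hε, H⟩ := Metric.eventually_nhds_iff.1 h1
  obtain ⟨hx0, hxa⟩ := hx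
  obtain ⟨hy0, hyb⟩ := hy
  obtain ⟨d, hd0, hd⟩ := exists_between (show 0 < min ε (min x (b - y)) from
    lt_min hε (lt_min hx0 (by linarith)))
  obtain ⟨d1, hd'⟩ := lt_min_iff.1 hd
  obtain ⟨d2, d3⟩ := lt_min_iff.1 hd'
  refine ⟨x - d, y + d, ⟨by linarith, by linarith⟩, ⟨by linarith, by linarith⟩, by ring, ?_, ?_⟩
  · exact hf ⟨by linarith, by linarith⟩ ⟨hx0, hxa⟩ (by linarith)
  · apply H
    simpa [Real.dist_eq, abs_of_pos hd0] using d1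

theorem mono_aux (c α N μ : ℝ) (hc : 0 < c) (hN : 0 < N) (hμ : 0 < μ) :
    StrictMonoOn (fun x => c * (α + (1 / μ) * Real.log (N / (N - x)))) (Set.Ioo 0 N) := by
  intro x hx y hy hxy
  have h1 : 0 < N - y := by linarith [hy.2]
  have h2 : 0 < N - x := by linarith [hx.2]
  have h3 : Real.log (N / (N - x)) < Real.log (N / (N - y)) := by
    apply Real.log_lt_log (by positivity)
    exact div_lt_div_of_pos_left hN h1 (by linarith)
  have h4 : 0 < 1 / μ := by positivity
  have h5 := mul_lt_mul_of_pos_left h3 h4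
  exact mul_lt_mul_of_pos_left (by linarith) hc

theorem cont_aux (c α N μ x : ℝ) (hN : 0 < N) (hx : x ∈ Set.Ioo 0 N) :
    ContinuousAt (fun x => c * (α + (1 / μ) * Real.log (N / (N - x)))) x := by
  have h1 : 0 < N - x := by linarith [hx.2]
  have h2 : ContinuousAt (fun x => N / (N - x)) x :=
    continuousAt_const.div (continuousAt_const.sub continuousAt_id) h1.ne'
  exact continuousAt_const.mul (continuousAt_const.add (continuousAt_const.mul
    (h2.log (div_pos hN h1).ne')))

/-- Balancing condition for the uniform load allocation with two groups: if `(r₁*, r₂*)`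
with `r₁* + r₂* = r` minimizes `max{λ₁(r₁), λ₂(r₂)}` where
`λ_j(r_j) = (l/k)(α + (1/μ_j)log(N_j/(N_j − r_j)))`, then `λ₁(r₁*) = λ₂(r₂*)`. -/
theorem uniform_two_group_balancing
    (k l α : ℝ) (hk : 0 < k) (hl : 0 < l) (hα : 0 < α)
    (N₁ N₂ μ₁ μ₂ : ℝ) (hN₁ : 0 < N₁) (hN₂ : 0 < N₂) (hμ₁ : 0 < μ₁) (hμ₂ : 0 < μ₂)
    (r : ℝ) (hr : 0 < r)
    (r₁ r₂ : ℝ) (hr₁ : r₁ ∈ Set.Ioo 0 N₁) (hr₂ : r₂ ∈ Set.Ioo 0 N₂)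
    (hsum : r₁ + r₂ = r)
    (hmin : ∀ s₁ s₂ : ℝ, s₁ ∈ Set.Ioo 0 N₁ → s₂ ∈ Set.Ioo 0 N₂ → s₁ + s₂ = r →
      max ((l / k) * (α + (1 / μ₁) * Real.log (N₁ / (N₁ - r₁))))
          ((l / k) * (α + (1 / μ₂) * Real.log (N₂ / (N₂ - r₂)))) ≤
      max ((l / k) * (α + (1 / μ₁) * Real.log (N₁ / (N₁ - s₁))))
          ((l / k) * (α + (1 / μ₂) * Real.log (N₂ / (N₂ - s₂))))) :
    (l / k) * (α + (1 / μ₁) * Real.log (N₁ / (N₁ - r₁))) =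
      (l / k) * (α + (1 / μ₂) * Real.log (N₂ / (N₂ - r₂))) := by
  have hc : 0 < l / k := div_pos hl hk
  rcases lt_trichotomy ((l / k) * (α + (1 / μ₁) * Real.log (N₁ / (N₁ - r₁))))
      ((l / k) * (α + (1 / μ₂) * Real.log (N₂ / (N₂ - r₂)))) with h | h | h
  · obtain ⟨s, t, hs, ht, hst, h1, h2⟩ := key_aux _ _ N₂ N₁ r₂ r₁ hr₂ hr₁
      (mono_aux (l / k) α N₂ μ₂ hc hN₂ hμ₂) (cont_aux (l / k) α N₁ μ₁ r₁ hN₁ hr₁) h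
    exact absurd ((le_max_right _ _).trans (hmin t s ht hs (by linarith)))
      (not_le.2 (max_lt h2 h1))
  · exact h
  · obtain ⟨s, t, hs, ht, hst, h1, h2⟩ := key_aux _ _ N₁ N₂ r₁ r₂ hr₁ hr₂
      (mono_aux (l / k) α N₁ μ₁ hc hN₁ hμ₁) (cont_aux (l / k) α N₂ μ₂ r₂ hN₂ hr₂) h
    exact absurd ((le_max_left _ _).trans (hmin s t hs ht (by linarith)))
      (not_le.2 (max_lt h1 h2))
end

section
/- Let G ≥ 1, k > 0, and for each j ∈ {1, …, G} let N_j, μ_j, α_j > 0. Let r_j* ∈ (0, N_j) be the unique solution of r/(μ_j(N_j − r)) = α_j + (1/μ_j)·log(N_j/(N_j − r)). Define f_b on S = ∏_{j=1}^{G} (0, N_j) by f_b(r) = k / ( Σ_{j=1}^{G} r_j / ξ_j(r_j) ), where ξ_j(r) = α_j + (1/μ_j)·log(N_j/(N_j − r)). Then f_b attains its global minimum on S uniquely at r* = (r_1*, …, r_G*), and the minimum value equals T_b* = k / ( Σ_{j=1}^{G} μ_j·(N_j − r_j*) ). -/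
open Real

lemma xi_pos_aux_s16 (N m a r : ℝ) (hm : 0 < m) (ha : 0 < a) (hr : r ∈ Set.Ioo (0 : ℝ) N) :
    0 < a + (1 / m) * Real.log (N / (N - r)) := by
  obtain ⟨h0, h1⟩ := hr
  have : 0 ≤ Real.log (N / (N - r)) := by
    apply Real.log_nonneg
    rw [le_div_iff₀ (by linarith)]
    linarith
  positivity

lemma group_val_aux (N m a s : ℝ) (hm : 0 < m) (hs : s ∈ Set.Ioo (0 : ℝ) N)
    (he : s / (m * (N - s)) = a + (1 / m) * Real.log (N / (N - s))) :
    s / (a + (1 / m) * Real.log (N / (N - s))) = m * (N - s) := by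
  obtain ⟨h0, h1⟩ := hs
  have : 0 < N - s := by linarith
  rw [← he]
  field_simp

lemma group_lt_aux (N m a s r : ℝ) (hm : 0 < m) (ha : 0 < a) (hs : s ∈ Set.Ioo (0 : ℝ) N)
    (hr : r ∈ Set.Ioo (0 : ℝ) N) (hne : r ≠ s)
    (he : s / (m * (N - s)) = a + (1 / m) * Real.log (N / (N - s))) :
    r / (a + (1 / m) * Real.log (N / (N - r))) <
      s / (a + (1 / m) * Real.log (N / (N - s))) := by
  rw [group_val_aux N m a s hm hs he, div_lt_iff₀ (xi_pos_aux_s16 N m a r hm ha hr)]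
  obtain ⟨h0, h1⟩ := hs
  obtain ⟨g0, g1⟩ := hr
  have p : 0 < N - s := by linarith
  have q : 0 < N - r := by linarith
  have hN : 0 < N := by linarith
  have hx : (N - r) / (N - s) ≠ 1 := by
    intro h
    rw [div_eq_one_iff_eq p.ne'] at h
    exact hne (by linarith)
  have hl := Real.log_lt_sub_one_of_pos (div_pos q p) hx
  rw [Real.log_div q.ne' p.ne'] at hl
  rw [Real.log_div hN.ne' p.ne'] at he
  rw [Real.log_div hN.ne' q.ne']
  have e1 : s = (N - s) * (m * a + (Real.log N - Real.log (N - s))) := by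
    rw [div_eq_iff (by positivity)] at he
    have : (a + 1 / m * (Real.log N - Real.log (N - s))) * (m * (N - s)) =
      (N - s) * (m * a + (Real.log N - Real.log (N - s))) := by
      field_simp
    linarith
  have e2 : m * (N - s) * (a + 1 / m * (Real.log N - Real.log (N - r))) =
      (N - s) * (m * a + (Real.log N - Real.log (N - r))) := by
    field_simp
  rw [e2]
  have h3 := mul_lt_mul_of_pos_left hl p
  have e3 : (N - s) * ((N - r) / (N - s) - 1) = s - r := by
    field_simp
    ring
  rw [e3] at h3
  linarith

/-- Under the alternative runtime model, the latency lower bound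
`f_b(r) = k/(Σ_j r_j/ξ_j(r_j))` attains its global minimum on the open box
`S = ∏_j (0, N_j)` uniquely at `r*`, with minimum value `k/(Σ_j μ_j(N_j − r_j*))`. -/
theorem latency_lower_bound_minimum_alt_model
    (G : ℕ) (hG : 1 ≤ G) (k : ℝ) (hk : 0 < k)
    (N μ α : Fin G → ℝ)
    (hN : ∀ j, 0 < N j) (hμ : ∀ j, 0 < μ j) (hα : ∀ j, 0 < α j)
    (rstar : Fin G → ℝ)
    (hstar : ∀ j, rstar j ∈ Set.Ioo (0 : ℝ) (N j) ∧
      rstar j / (μ j * (N j - rstar j)) = α j + (1 / μ j) * Real.log (N j / (N j - rstar j)))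
    (huniq : ∀ j, ∀ r ∈ Set.Ioo (0 : ℝ) (N j),
      r / (μ j * (N j - r)) = α j + (1 / μ j) * Real.log (N j / (N j - r)) → r = rstar j) :
    (∀ r ∈ Set.univ.pi fun j => Set.Ioo (0 : ℝ) (N j),
        (k / ∑ j, rstar j / (α j + (1 / μ j) * Real.log (N j / (N j - rstar j)))) ≤
          k / ∑ j, r j / (α j + (1 / μ j) * Real.log (N j / (N j - r j)))) ∧
    (∀ r ∈ Set.univ.pi fun j => Set.Ioo (0 : ℝ) (N j),
        (k / ∑ j, r j / (α j + (1 / μ j) * Real.log (N j / (N j - r j)))) =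
          (k / ∑ j, rstar j / (α j + (1 / μ j) * Real.log (N j / (N j - rstar j)))) →
        r = rstar) ∧
    (k / ∑ j, rstar j / (α j + (1 / μ j) * Real.log (N j / (N j - rstar j)))) =
      k / ∑ j, μ j * (N j - rstar j) := by
  have hle : ∀ r ∈ Set.univ.pi fun j => Set.Ioo (0 : ℝ) (N j), ∀ j,
      r j / (α j + (1 / μ j) * Real.log (N j / (N j - r j))) ≤
        rstar j / (α j + (1 / μ j) * Real.log (N j / (N j - rstar j))) := by
    intro r hr j
    by_cases h : r j = rstar j
    · rw [h]
    · exact (group_lt_aux _ _ _ _ _ (hμ j) (hα j) (hstar j).1 (hr j trivial) h (hstar j).2).le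
  have hpos : ∀ r ∈ Set.univ.pi fun j => Set.Ioo (0 : ℝ) (N j),
      0 < ∑ j, r j / (α j + (1 / μ j) * Real.log (N j / (N j - r j))) := by
    intro r hr
    apply Finset.sum_pos
    · intro j _
      exact div_pos (hr j trivial).1 (xi_pos_aux_s16 _ _ _ _ (hμ j) (hα j) (hr j trivial))
    · exact ⟨⟨0, hG⟩, Finset.mem_univ _⟩
  refine ⟨?_, ?_, ?_⟩
  · intro r hr
    exact div_le_div_of_nonneg_left hk.le (hpos r hr) (Finset.sum_le_sum fun j _ => hle r hr j)
  · intro r hr h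
    by_contra hne
    obtain ⟨j, hj⟩ := Function.ne_iff.mp hne
    have hlt := Finset.sum_lt_sum (fun j (_ : j ∈ Finset.univ) => hle r hr j)
      ⟨j, Finset.mem_univ j,
        group_lt_aux _ _ _ _ _ (hμ j) (hα j) (hstar j).1 (hr j trivial) hj (hstar j).2⟩
    exact (div_lt_div_of_pos_left hk (hpos r hr) hlt).ne h.symm
  · congr 1
    exact Finset.sum_congr rfl fun j _ => group_val_aux _ _ _ _ (hμ j) (hstar j).1 (hstar j).2
end

section
/- For every c > 0 there exists a unique q ∈ (0, 1) such that q/(1 − q) + log(1 − q) = c; denote it q*(c). Moreover, the map c ↦ q*(c) is strictly increasing on (0, ∞). Consequently, for a single group of workers with fixed shift parameter α > 0, the optimal MDS code rate k/n* = q*(αμ) is a strictly increasing function of the straggling parameter μ > 0. -/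
open Real

theorem aux_mono {a b : ℝ} (ha : 0 ≤ a) (hab : a < b) (hb : b < 1) :
    a / (1 - a) + Real.log (1 - a) < b / (1 - b) + Real.log (1 - b) := by
  have hx : 0 < 1 - a := by linarith
  have hy : 0 < 1 - b := by linarith
  have h1 : Real.log ((1 - a) / (1 - b)) < (1 - a) / (1 - b) - 1 := by
    apply Real.log_lt_sub_one_of_pos (by positivity)
    intro h
    rw [div_eq_one_iff_eq hy.ne'] at h
    linarith
  rw [Real.log_div hx.ne' hy.ne'] at h1
  have h2 : (1 - a) / (1 - b) - 1 ≤ b / (1 - b) - a / (1 - a) := by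
    have : b / (1 - b) - a / (1 - a) - ((1 - a) / (1 - b) - 1)
        = a * (b - a) / ((1 - b) * (1 - a)) := by
      field_simp
      ring
    have h3 : 0 ≤ a * (b - a) / ((1 - b) * (1 - a)) :=
      div_nonneg (mul_nonneg ha (by linarith)) (by positivity)
    linarith
  linarith

theorem aux_exists {c : ℝ} (hc : 0 < c) : ∃ q : ℝ, q ∈ Set.Ioo (0 : ℝ) 1 ∧
    q / (1 - q) + Real.log (1 - q) = c := by
  have ht : 0 < 2 * c + 2 := by linarith
  have hx0 : 0 < 1 / (2 * c + 2) := by positivity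
  have hx1 : 1 / (2 * c + 2) < 1 := by rw [div_lt_one ht]; linarith
  have hcont : ContinuousOn (fun q : ℝ => q / (1 - q) + Real.log (1 - q))
      (Set.Icc 0 (1 - 1 / (2 * c + 2))) := by
    have hne : ∀ q ∈ Set.Icc (0 : ℝ) (1 - 1 / (2 * c + 2)), 1 - q ≠ 0 := by
      intro q hq
      have := hq.2
      linarith
    exact (continuousOn_id.div (by fun_prop) hne).add
      (ContinuousOn.log (by fun_prop) hne)
  have hlog : Real.log (2 * c + 2) < c + 1 := by
    have h1 : Real.log (2 * (c + 1)) = Real.log 2 + Real.log (c + 1) :=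
      Real.log_mul (by norm_num) (by linarith)
    have h2 := Real.log_le_sub_one_of_pos (show 0 < c + 1 by linarith)
    have h3 := Real.log_two_lt_d9
    rw [show 2 * c + 2 = 2 * (c + 1) by ring, h1]
    linarith
  have hmem : c ∈ Set.Icc ((fun q : ℝ => q / (1 - q) + Real.log (1 - q)) 0)
      ((fun q : ℝ => q / (1 - q) + Real.log (1 - q)) (1 - 1 / (2 * c + 2))) := by
    constructor
    · simp [hc.le]
    · have e1 : (1 - 1 / (2 * c + 2)) / (1 - (1 - 1 / (2 * c + 2))) = 2 * c + 1 := by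
        rw [sub_sub_cancel]
        field_simp
        ring
      have e2 : Real.log (1 - (1 - 1 / (2 * c + 2))) = - Real.log (2 * c + 2) := by
        rw [sub_sub_cancel, one_div, Real.log_inv]
      simp only [e1, e2]
      linarith
  obtain ⟨q, hq, hqc⟩ := intermediate_value_Icc (by linarith) hcont hmem
  refine ⟨q, ⟨lt_of_le_of_ne hq.1 ?_, by linarith [hq.2]⟩, hqc⟩
  rintro rfl
  simp at hqc
  linarith

/-- For every `c > 0` there is a unique `q ∈ (0,1)` with `q/(1−q) + log(1−q) = c`; the map
`c ↦ q*(c)` is strictly increasing, and consequently for a fixed shift parameter `α > 0`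
the optimal MDS code rate `k/n* = q*(αμ)` is strictly increasing in the straggling
parameter `μ > 0`. -/
theorem optimal_rate_strictly_increasing :
    (∀ c : ℝ, 0 < c → ∃! q : ℝ, q ∈ Set.Ioo (0 : ℝ) 1 ∧
        q / (1 - q) + Real.log (1 - q) = c) ∧
    (∀ qf : ℝ → ℝ,
      (∀ c : ℝ, 0 < c → qf c ∈ Set.Ioo (0 : ℝ) 1 ∧
        qf c / (1 - qf c) + Real.log (1 - qf c) = c) →
      StrictMonoOn qf (Set.Ioi (0 : ℝ)) ∧
      (∀ α : ℝ, 0 < α → StrictMonoOn (fun μ : ℝ => qf (α * μ)) (Set.Ioi (0 : ℝ)))) := by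
  refine ⟨fun c hc => ?_, fun qf h => ?_⟩
  · obtain ⟨q, hq, hqc⟩ := aux_exists hc
    refine ⟨q, ⟨hq, hqc⟩, ?_⟩
    rintro p ⟨hp, hpc⟩
    rcases lt_trichotomy p q with hlt | heq | hlt
    · have := aux_mono hp.1.le hlt hq.2
      linarith
    · exact heq
    · have := aux_mono hq.1.le hlt hp.2
      linarith
  · have hm : StrictMonoOn qf (Set.Ioi (0 : ℝ)) := by
      intro c hc d hd hcd
      obtain ⟨hc1, hc2⟩ := h c hc
      obtain ⟨hd1, hd2⟩ := h d hd
      by_contra hn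
      rcases (not_lt.mp hn).lt_or_eq with hlt | heq
      · have := aux_mono hd1.1.le hlt hc1.2
        linarith
      · rw [heq] at hd2
        linarith
    refine ⟨hm, fun α hα x hx y hy hxy => ?_⟩
    exact hm (mul_pos hα hx) (mul_pos hα hy) (mul_lt_mul_of_pos_left hxy hα)
end
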